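/- arXiv:2506.13591 — 3 statements merged into one kernel-verified Lean document; each statement's English description precedes it below -/
import Mathlib

section
/- Let I be a reflexive fractional ideal of R and let z be a reduction of ω_R:I. Then there exists an element w ∈ R̄ that is invertible in R̄ such that C ⊆ wzI ⊆ R. In particular, every reflexive fractional ideal is isomorphic to an ideal of R containing the conductor C. -/
open scoped nonZeroDivisors

noncomputable section

/-- `x ∈ R` is integral over the ideal `I`: it satisfies an equation of integral
dependence over `I`, i.e. a monic polynomial whose coefficient in degree
`deg - i` lies in `I ^ i`. -/
def IsIntegralOverIdeal {R : Type*} [CommRing R] (I : Ideal R) (x : R) : Prop :=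
  ∃ p : Polynomial R, p.Monic ∧ (∀ i < p.natDegree, p.coeff i ∈ I ^ (p.natDegree - i)) ∧
    Polynomial.eval x p = 0

/-- The integral closure of the ideal `I`, viewed as an `R`-submodule of `Q(R)`. -/
def intCl (R : Type*) [CommRing R] (I : Ideal R) : Submodule R (FractionRing R) :=
  Submodule.span R (algebraMap R (FractionRing R) '' {r : R | IsIntegralOverIdeal I r})

/-- `J` is a reduction of `I`: `J ⊆ I` and `J I^n = I^(n+1)` for some `n`. -/
def IsIdealReduction {R : Type*} [CommRing R] (J I : Ideal R) : Prop :=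
  J ≤ I ∧ ∃ n : ℕ, J * I ^ n = I ^ (n + 1)

/-- `J` is a minimal reduction of `I`: no reduction of `I` is properly contained in `J`. -/
def IsMinimalReduction {R : Type*} [CommRing R] (J I : Ideal R) : Prop :=
  IsIdealReduction J I ∧ ∀ K : Ideal R, IsIdealReduction K I → K ≤ J → K = J

/-- The ideal `I` of `R`, viewed as an `R`-submodule of `Q(R)`. -/
def idl (R : Type*) [CommRing R] (I : Ideal R) : Submodule R (FractionRing R) :=
  Submodule.map (Algebra.linearMap R (FractionRing R)) I

/-- The integral closure `R̄` of `R` in `Q(R)`, as an `R`-submodule of `Q(R)`. -/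
def Rbar (R : Type*) [CommRing R] : Submodule R (FractionRing R) :=
  Subalgebra.toSubmodule (integralClosure R (FractionRing R))

/-- The condC `C = R : R̄`, as an `R`-submodule of `Q(R)`. -/
def condC (R : Type*) [CommRing R] : Submodule R (FractionRing R) :=
  1 / Rbar R

/-- The product `z • I` of a submodule `I` of `Q(R)` by an element `z ∈ Q(R)`. -/
def smulQ {R : Type*} [CommRing R] (z : FractionRing R)
    (I : Submodule R (FractionRing R)) : Submodule R (FractionRing R) :=
  Submodule.span R {z} * I

/-- `I` is a (regular) fractional ideal of `R`: it contains a regular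
(= invertible) element of `Q(R)`, and `yI ⊆ R` for some regular `y ∈ R`. -/
def IsFracIdeal {R : Type*} [CommRing R] (I : Submodule R (FractionRing R)) : Prop :=
  (∃ u : (FractionRing R)ˣ, (u : FractionRing R) ∈ I) ∧
    ∃ y ∈ R⁰, smulQ (algebraMap R (FractionRing R) y) I ≤ 1

/-- `z ∈ Q(R)` is a reduction of the fractional ideal `F`: `z = x/y` with `y`
regular in `R`, `yF ⊆ R`, and `(x)` a minimal reduction of the ideal `yF` of `R`. -/
def IsFracReduction {R : Type*} [CommRing R] (z : FractionRing R)
    (F : Submodule R (FractionRing R)) : Prop :=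
  ∃ x y : R, y ∈ R⁰ ∧
    z * algebraMap R (FractionRing R) y = algebraMap R (FractionRing R) x ∧
    smulQ (algebraMap R (FractionRing R) y) F ≤ 1 ∧
    IsMinimalReduction (Ideal.span {x})
      (Submodule.comap (Algebra.linearMap R (FractionRing R))
        (smulQ (algebraMap R (FractionRing R) y) F))

section PrimitiveRelation

open Polynomial

theorem length_quotient_ne_top {R : Type*} [CommRing R] [IsNoetherianRing R]
    (hdim : ringKrullDim R = 1) {M : Ideal R} {b : R} (hb : b ∈ R⁰) (hbM : b ∈ M) :
    Module.length R (R ⧸ M) ≠ ⊤ := by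
  have : Ring.KrullDimLE 1 R := Ring.krullDimLE_iff.mpr hdim.le
  have hle : Ideal.span {b} ≤ M := (Ideal.span_singleton_le_iff_mem M).mpr hbM
  exact ne_top_of_le_ne_top
    (Module.length_ne_top_iff.mpr (isFiniteLength_quotient_span_singleton R hb))
    (Module.length_le_of_surjective _ (Submodule.factor_surjective hle))

/-- A linear form on `R ^ n` whose kernel lies in `𝔪 R ^ n` and whose image is regular
exists only for `n` at most the length of `R / aR`, for any regular `a ∈ 𝔪`. -/
theorem natCast_le_length_of_ker_le {R : Type*} [CommRing R] [IsNoetherianRing R] [IsLocalRing R]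
    (hdim : ringKrullDim R = 1) {a : R} (ha : a ∈ R⁰) (ham : a ∈ IsLocalRing.maximalIdeal R)
    {n : ℕ} (φ : (Fin n → R) →ₗ[R] R) {b : R} (hb : b ∈ R⁰) (hbφ : b ∈ LinearMap.range φ)
    (hker : ∀ v, φ v = 0 → ∀ i, v i ∈ IsLocalRing.maximalIdeal R) :
    (n : ℕ∞) ≤ Module.length R (R ⧸ Ideal.span {a}) := by
  let M : Ideal R := LinearMap.range φ
  let L : Ideal R := Ideal.span {a} * M
  have hLM : L ≤ M := Ideal.mul_le_right
  have hLa : L ≤ Ideal.span {a} := Ideal.mul_le_left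
  have memL : ∀ t, t ∈ L ↔ ∃ m ∈ M, a * m = t := fun t => Ideal.mem_span_singleton_mul
  let ψ : (Fin n → R) →ₗ[R] R ⧸ L := L.mkQ ∘ₗ φ
  have hψ : ∀ v, ψ v = 0 ↔ φ v ∈ L := fun v => Submodule.Quotient.mk_eq_zero L
  have e1 := Module.length_eq_add_of_exact (R := R) (LinearMap.range ψ).subtype
    (Submodule.factor hLM) (Submodule.subtype_injective _) (Submodule.factor_surjective hLM) (by
      rw [LinearMap.exact_iff, Submodule.range_subtype]
      ext t
      obtain ⟨t, rfl⟩ := Submodule.Quotient.mk_surjective _ t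
      constructor
      · intro h
        obtain ⟨v, rfl⟩ := (Submodule.Quotient.mk_eq_zero M).mp h
        exact ⟨v, rfl⟩
      · rintro ⟨v, hv⟩
        rw [← hv]
        exact (Submodule.Quotient.mk_eq_zero M).mpr ⟨v, rfl⟩)
  have hle : M ≤ Submodule.comap (LinearMap.mulLeft R a) L := fun m hm => (memL _).mpr ⟨m, hm, rfl⟩
  have e2 := Module.length_eq_add_of_exact (R := R)
    (Submodule.mapQ M L (LinearMap.mulLeft R a) hle) (Submodule.factor hLa) (by
      rw [← LinearMap.ker_eq_bot, LinearMap.ker_eq_bot']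
      intro t ht
      obtain ⟨t, rfl⟩ := Submodule.Quotient.mk_surjective _ t
      obtain ⟨m, hm, h⟩ := (memL _).mp ((Submodule.Quotient.mk_eq_zero L).mp ht)
      have : m = t := (mul_cancel_left_mem_nonZeroDivisors ha).mp h
      exact (Submodule.Quotient.mk_eq_zero M).mpr (this ▸ hm))
      (Submodule.factor_surjective hLa) (by
      intro t
      obtain ⟨t, rfl⟩ := Submodule.Quotient.mk_surjective _ t
      constructor
      · intro h
        obtain ⟨s, rfl⟩ := Ideal.mem_span_singleton'.mp
          ((Submodule.Quotient.mk_eq_zero (Ideal.span {a})).mp h)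
        exact ⟨Submodule.Quotient.mk s, congrArg Submodule.Quotient.mk (mul_comm a s)⟩
      · rintro ⟨s, hs⟩
        obtain ⟨s, rfl⟩ := Submodule.Quotient.mk_surjective _ s
        rw [← hs]
        exact (Submodule.Quotient.mk_eq_zero (Ideal.span {a})).mpr
          (Ideal.mul_mem_right _ _ (Ideal.mem_span_singleton_self a)))
  have e3 : Module.length R (LinearMap.range ψ) = Module.length R (R ⧸ Ideal.span {a}) := by
    rw [e2, add_comm] at e1
    exact (ENat.add_left_injective_of_ne_top (length_quotient_ne_top hdim hb hbφ) e1).symm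
  let κ : (Fin n → R) →ₗ[R] (Fin n → R ⧸ IsLocalRing.maximalIdeal R) :=
    LinearMap.pi fun i => (IsLocalRing.maximalIdeal R).mkQ ∘ₗ LinearMap.proj i
  have hκ : LinearMap.ker ψ ≤ LinearMap.ker κ := by
    intro v hv
    obtain ⟨_, ⟨q, rfl⟩, hq⟩ := (memL _).mp ((hψ v).mp hv)
    ext i
    refine (Submodule.Quotient.mk_eq_zero _).mpr ?_
    have h := hker (v - a • q) (by rw [map_sub, map_smul, smul_eq_mul, hq, sub_self]) i
    have h' := add_mem h (Ideal.mul_mem_right (q i) _ ham)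
    simpa using h'
  have hsurj : Function.Surjective ((LinearMap.ker ψ).liftQ κ hκ) := by
    intro y
    choose x hx using fun i => Submodule.Quotient.mk_surjective _ (y i)
    exact ⟨Submodule.Quotient.mk x, funext hx⟩
  have hlen := Module.length_le_of_surjective _ hsurj
  have : IsSimpleModule R (R ⧸ IsLocalRing.maximalIdeal R) :=
    isSimpleModule_iff_isCoatom.mpr (IsLocalRing.maximalIdeal.isMaximal R).out
  rw [Module.length_pi, Module.length_eq_one, ψ.quotKerEquivRange.length_eq, e3] at hlen
  simpa using hlen

/-- Every element of the total ring of fractions is a root of a polynomial over `R` with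
a unit among its coefficients. -/
theorem exists_isUnit_coeff_and_aeval_eq_zero {R : Type*} [CommRing R] [IsNoetherianRing R]
    [IsLocalRing R] (hdim : ringKrullDim R = 1)
    (hCM : ∃ x ∈ IsLocalRing.maximalIdeal R, x ∈ R⁰) (x : FractionRing R) :
    ∃ p : R[X], (∃ i, IsUnit (p.coeff i)) ∧ aeval x p = 0 := by
  obtain ⟨a, ham, ha⟩ := hCM
  obtain ⟨N, hN⟩ := ENat.ne_top_iff_exists.mp
    (length_quotient_ne_top hdim ha (Ideal.mem_span_singleton_self a))
  obtain ⟨⟨c, b⟩, hcb⟩ := IsLocalization.surj R⁰ x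
  let φ : (Fin (N + 1) → R) →ₗ[R] R :=
    Fintype.linearCombination R fun i : Fin (N + 1) => c ^ (i : ℕ) * (b : R) ^ (N - i)
  have hφ : ∀ v, φ v = ∑ i, v i * (c ^ (i : ℕ) * (b : R) ^ (N - i)) := fun v => by
    simp [φ, Fintype.linearCombination_apply]
  by_contra! hcon
  have hle := natCast_le_length_of_ker_le hdim ha ham φ (pow_mem b.2 N)
    ⟨Pi.single 0 1, by simp [φ]⟩ (by
      intro v hv i
      by_contra hi
      have hi : IsUnit (v i) := by simpa using hi
      refine hcon (∑ j : Fin (N + 1), C (v j) * X ^ (j : ℕ)) ⟨i, ?_⟩ ?_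
      · simpa [finsetSum_coeff, coeff_C_mul, coeff_X_pow, Fin.val_inj] using hi
      · have hbu : IsUnit (algebraMap R (FractionRing R) b ^ N) :=
          (IsLocalization.map_units (FractionRing R) b).pow N
        rw [← hbu.mul_left_inj, zero_mul, ← map_zero (algebraMap R (FractionRing R)), ← hv, hφ]
        simp only [map_sum, map_mul, map_pow, aeval_C, aeval_X, Finset.sum_mul]
        refine Finset.sum_congr rfl fun j _ => ?_
        rw [← hcb, mul_pow, mul_assoc (x ^ (j : ℕ)), ← pow_add,
          Nat.add_sub_cancel' (Nat.lt_succ_iff.mp j.2), mul_assoc])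
  rw [← hN] at hle
  exact absurd (Nat.cast_le.mp hle) (by omega)

/-- Over a local ring with infinite residue field, a root `x` of a polynomial with a unit
coefficient becomes the inverse of an integral element after a translation. -/
theorem exists_isIntegral_mul_sub_eq_one {R S : Type*} [CommRing R] [IsLocalRing R]
    [Infinite (IsLocalRing.ResidueField R)] [CommRing S] [Algebra R S] {x : S} {p : R[X]}
    (hp : ∃ i, IsUnit (p.coeff i)) (hx : aeval x p = 0) :
    ∃ (s : R) (y : S), IsIntegral R y ∧ y * (x - algebraMap R S s) = 1 := by
  obtain ⟨i, hi⟩ := hp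
  have hp0 : p.map (IsLocalRing.residue R) ≠ 0 := fun h => by
    have := congrArg (fun q => q.coeff i) h
    rw [coeff_map, coeff_zero] at this
    exact (hi.map (IsLocalRing.residue R)).ne_zero this
  obtain ⟨s, hs⟩ : ∃ s : R, IsUnit (p.eval s) := by
    by_contra! h
    refine hp0 (eq_zero_of_infinite_isRoot _ (Set.infinite_univ.mono fun t _ => ?_))
    obtain ⟨t, rfl⟩ := IsLocalRing.residue_surjective t
    rw [Set.mem_ofPred_eq, IsRoot, eval_map_apply, IsLocalRing.residue_eq_zero_iff]
    exact h t
  let q : R[X] := taylor s p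
  have hq0 : IsUnit (q.coeff 0) := by rwa [taylor_coeff_zero]
  have hqx : aeval (x - algebraMap R S s) q = 0 := by
    rw [show q = taylor s p from rfl, taylor_apply, aeval_comp]
    simpa using hx
  have hunit : IsUnit (x - algebraMap R S s) := by
    rw [← divX_mul_X_add q, map_add, map_mul, aeval_X, aeval_C] at hqx
    have h := (hq0.map (algebraMap R S)).neg
    rw [← eq_neg_of_add_eq_zero_left hqx] at h
    exact isUnit_of_mul_isUnit_right h
  obtain ⟨u, hu⟩ := hunit
  refine ⟨s, ↑u⁻¹, ?_, by rw [← hu, Units.inv_mul]⟩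
  obtain ⟨c, hc⟩ := hq0
  refine ⟨C (↑c⁻¹ : R) * q.reverse, ?_, ?_⟩
  · refine monic_C_mul_of_mul_leadingCoeff_eq_one ?_
    have : q.natTrailingDegree = 0 := natTrailingDegree_eq_zero.mpr
      (.inr (hc ▸ c.ne_zero))
    rw [reverse_leadingCoeff, trailingCoeff, this, ← hc, Units.inv_mul]
  · let := u.invertible
    have := (eval₂_reverse_eq_zero_iff (algebraMap R S) (u : S) q).mpr (by rwa [hu])
    rw [eval₂_mul]
    rw [invOf_units] at this
    rw [this, mul_zero]

end PrimitiveRelation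

/-- An element of an algebra stabilizing a finitely generated submodule that contains a unit
is integral. -/
theorem isIntegral_of_mul_mem {R S : Type*} [CommRing R] [IsNoetherianRing R] [CommRing S]
    [Algebra R S] {N : Submodule R S} (hN : N.FG) {u : S} (huN : u ∈ N) (hu : IsUnit u) {t : S}
    (ht : ∀ b ∈ N, t * b ∈ N) : IsIntegral R t := by
  obtain ⟨u, rfl⟩ := hu
  refine IsIntegral.of_mem_of_fg (Algebra.adjoin R {t})
    ((hN.map (LinearMap.mulRight R (↑u⁻¹ : S))).of_le fun s hs => ?_) t
    (Algebra.self_mem_adjoin_singleton R t)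
  have hsN : ∀ b ∈ N, s * b ∈ N := by
    induction hs using Algebra.adjoin_induction with
    | mem x hx => rwa [Set.mem_singleton_iff.mp hx]
    | algebraMap r => exact fun b hb => Algebra.smul_def r b ▸ N.smul_mem r hb
    | add x y _ _ hx hy => exact fun b hb => add_mul x y b ▸ add_mem (hx b hb) (hy b hb)
    | mul x y _ _ hx hy => exact fun b hb => mul_assoc x y b ▸ hx _ (hy b hb)
  exact ⟨s * u, hsN u huN, u.mul_inv_cancel_right s⟩

theorem mem_smulQ {R : Type*} [CommRing R] {z x : FractionRing R}
    {I : Submodule R (FractionRing R)} : x ∈ smulQ z I ↔ ∃ t ∈ I, z * t = x :=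
  Submodule.mem_span_singleton_mul

theorem mem_Rbar {R : Type*} [CommRing R] {x : FractionRing R} : x ∈ Rbar R ↔ IsIntegral R x :=
  Iff.rfl

/-- A finitely generated regular submodule of `Q(R)` becomes principal over `R̄`, generated by
one of its own elements. -/
theorem exists_unit_forall_isIntegral_mul_inv {R : Type*} [CommRing R] [IsNoetherianRing R]
    [IsLocalRing R] [Infinite (IsLocalRing.ResidueField R)] (hdim : ringKrullDim R = 1)
    (hCM : ∃ x ∈ IsLocalRing.maximalIdeal R, x ∈ R⁰) {K : Submodule R (FractionRing R)}
    (hK : K.FG) {u : (FractionRing R)ˣ} (hu : (u : FractionRing R) ∈ K) :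
    ∃ g : (FractionRing R)ˣ, (g : FractionRing R) ∈ K ∧
      ∀ k ∈ K, IsIntegral R (k * (↑g⁻¹ : FractionRing R)) := by
  classical
  obtain ⟨t, rfl⟩ := hK
  suffices h : ∀ T : Finset (FractionRing R), T ⊆ t → ∃ g : (FractionRing R)ˣ,
      (g : FractionRing R) ∈ Submodule.span R (t : Set (FractionRing R)) ∧
      ∀ k ∈ T, IsIntegral R (k * (↑g⁻¹ : FractionRing R)) by
    obtain ⟨g, hg, h⟩ := h t subset_rfl
    refine ⟨g, hg, fun k hk => ?_⟩
    have hle : Submodule.span R (t : Set (FractionRing R)) ≤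
        (Rbar R).comap (LinearMap.mulRight R (↑g⁻¹ : FractionRing R)) :=
      Submodule.span_le.mpr h
    exact hle hk
  intro T
  induction T using Finset.induction_on with
  | empty => exact fun _ => ⟨u, hu, by simp⟩
  | insert x T _ ih =>
    intro hT
    obtain ⟨hx, hT⟩ := Finset.insert_subset_iff.mp hT
    obtain ⟨g, hg, h⟩ := ih hT
    obtain ⟨p, hp, hpx⟩ :=
      exists_isUnit_coeff_and_aeval_eq_zero hdim hCM (x * (↑g⁻¹ : FractionRing R))
    obtain ⟨s, y, hy, hys⟩ := exists_isIntegral_mul_sub_eq_one hp hpx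
    let v : (FractionRing R)ˣ := ⟨x * (↑g⁻¹ : FractionRing R) - algebraMap R _ s, y,
      by rw [mul_comm, hys], hys⟩
    have hgv : ∀ k, k * (↑(g * v)⁻¹ : FractionRing R) = k * (↑g⁻¹ : FractionRing R) * y :=
      fun k => by
        rw [mul_inv, Units.val_mul, ← mul_assoc]
        rfl
    refine ⟨g * v, ?_, ?_⟩
    · have : ((g * v : (FractionRing R)ˣ) : FractionRing R) = x - s • (g : FractionRing R) := by
        rw [Units.val_mul, Algebra.smul_def]
        change (g : FractionRing R) * (x * (↑g⁻¹ : FractionRing R) - algebraMap R _ s) = _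
        linear_combination x * g.mul_inv
      rw [this]
      exact sub_mem (Submodule.subset_span hx) (Submodule.smul_mem _ s hg)
    · intro k hk
      rw [hgv]
      rcases Finset.mem_insert.mp hk with rfl | hk
      · have : k * (↑g⁻¹ : FractionRing R) * y = 1 + algebraMap R (FractionRing R) s * y := by
          linear_combination hys
        rw [this]
        exact isIntegral_one.add (isIntegral_algebraMap.mul hy)
      · exact (h k hk).mul hy

theorem IsFracIdeal.fg {R : Type*} [CommRing R] [IsNoetherianRing R]
    {K : Submodule R (FractionRing R)} (hK : IsFracIdeal K) : K.FG := by
  obtain ⟨-, y, hy, hyK⟩ := hK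
  obtain ⟨v, hv⟩ := IsLocalization.map_units (FractionRing R) (⟨y, hy⟩ : R⁰)
  have hle : K ≤ Submodule.span R {(↑v⁻¹ : FractionRing R)} := by
    intro k hk
    obtain ⟨r, hr⟩ := Submodule.mem_one.mp (hyK (mem_smulQ.mpr ⟨k, hk, rfl⟩))
    refine Submodule.mem_span_singleton.mpr ⟨r, ?_⟩
    rw [Algebra.smul_def, hr, ← hv]
    linear_combination k * v.mul_inv
  exact (Submodule.fg_span_singleton _).of_le hle

theorem IsFracIdeal.one_div {R : Type*} [CommRing R]
    {I : Submodule R (FractionRing R)} (hI : IsFracIdeal I) : IsFracIdeal (1 / I) := by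
  obtain ⟨⟨u, hu⟩, y, hy, hyI⟩ := hI
  obtain ⟨v, hv⟩ := IsLocalization.map_units (FractionRing R) (⟨y, hy⟩ : R⁰)
  refine ⟨⟨v, Submodule.mem_div_iff_forall_mul_mem.mpr fun k hk =>
    hyI (mem_smulQ.mpr ⟨k, hk, by rw [hv]⟩)⟩, ?_⟩
  obtain ⟨⟨a, s⟩, has⟩ := IsLocalization.surj R⁰ (u : FractionRing R)
  refine ⟨a, ?_, ?_⟩
  · have : IsUnit (algebraMap R (FractionRing R) a) :=
      has ▸ u.isUnit.mul (IsLocalization.map_units _ s)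
    exact mem_nonZeroDivisors_of_injective (IsLocalization.injective (FractionRing R) le_rfl)
      this.mem_nonZeroDivisors
  · intro x hx
    obtain ⟨t, ht, rfl⟩ := mem_smulQ.mp hx
    obtain ⟨r, hr⟩ := Submodule.mem_one.mp (Submodule.mem_div_iff_forall_mul_mem.mp ht u hu)
    refine Submodule.mem_one.mpr ⟨s * r, ?_⟩
    rw [map_mul, hr]
    linear_combination t * has

theorem IsFracIdeal.mul {R : Type*} [CommRing R] {I J : Submodule R (FractionRing R)}
    (hI : IsFracIdeal I) (hJ : IsFracIdeal J) : IsFracIdeal (I * J) := by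
  obtain ⟨⟨u, hu⟩, y, hy, hyI⟩ := hI
  obtain ⟨⟨v, hv⟩, x, hx, hxJ⟩ := hJ
  refine ⟨⟨u * v, Submodule.mul_mem_mul hu hv⟩, y * x, mul_mem hy hx, ?_⟩
  have : smulQ (algebraMap R (FractionRing R) (y * x)) (I * J) =
      smulQ (algebraMap R _ y) I * smulQ (algebraMap R _ x) J := by
    rw [smulQ, smulQ, smulQ, mul_mul_mul_comm, Submodule.span_mul_span, Set.singleton_mul_singleton,
      map_mul]
  rw [this]
  exact (mul_le_mul' hyI hxJ).trans (one_mul 1).le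

/-- For a reflexive `I`, the dual of `I` into a canonical ideal `ω` is `ω (R : I)`. -/
theorem canonical_div_eq_mul_one_div {R : Type*} [CommRing R]
    {ω : Submodule R (FractionRing R)} (hωfrac : IsFracIdeal ω)
    (hωcan : ∀ I : Submodule R (FractionRing R), IsFracIdeal I → ω / (ω / I) = I)
    {I : Submodule R (FractionRing R)} (hI : IsFracIdeal I)
    (hIrefl : (1 : Submodule R (FractionRing R)) / (1 / I) = I) :
    ω / I = ω * (1 / I) := by
  have h1 : ω / 1 = ω := by
    ext x
    refine ⟨fun h => ?_, fun h => Submodule.mem_div_iff_forall_mul_mem.mpr fun y hy => ?_⟩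
    · simpa using Submodule.mem_div_iff_forall_mul_mem.mp h 1 (Submodule.mem_one.mpr ⟨1, map_one _⟩)
    · obtain ⟨r, rfl⟩ := Submodule.mem_one.mp hy
      rw [mul_comm, ← Algebra.smul_def]
      exact ω.smul_mem r h
  have hone : IsFracIdeal (1 : Submodule R (FractionRing R)) :=
    ⟨⟨1, Submodule.mem_one.mpr ⟨1, map_one _⟩⟩, 1, one_mem _, by
      rw [smulQ, map_one, ← Submodule.one_eq_span, one_mul]⟩
  have hωω : ω / ω = 1 := by simpa only [h1] using hωcan 1 hone
  have hdiv : ω / (ω * (1 / I)) = I := by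
    suffices h : ω / (ω * (1 / I)) = ω / ω / (1 / I) by rw [h, hωω, hIrefl]
    refine eq_of_forall_le_iff fun X => ?_
    rw [Submodule.le_div_iff_mul_le, Submodule.le_div_iff_mul_le, Submodule.le_div_iff_mul_le,
      mul_comm ω, mul_assoc]
  rw [← hωcan _ (hωfrac.mul hI.one_div), hdiv]

theorem IsFracReduction.mem_and_isIntegral {R : Type*} [CommRing R] [IsNoetherianRing R]
    {z : FractionRing R} {F : Submodule R (FractionRing R)}
    (hF : ∃ u : (FractionRing R)ˣ, (u : FractionRing R) ∈ F) (hz : IsFracReduction z F) :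
    z ∈ F ∧ ∃ v : (FractionRing R)ˣ, (v : FractionRing R) = z ∧
      ∀ f ∈ F, IsIntegral R (f * (↑v⁻¹ : FractionRing R)) := by
  obtain ⟨x, y, hy, hzy, hyF, ⟨hxA, n, hn⟩, -⟩ := hz
  set A := Submodule.comap (Algebra.linearMap R (FractionRing R))
    (smulQ (algebraMap R (FractionRing R) y) F) with hA
  have hyu := IsLocalization.map_units (FractionRing R) (⟨y, hy⟩ : R⁰)
  have memA : ∀ f ∈ F, ∃ a ∈ A, algebraMap R (FractionRing R) a = algebraMap R _ y * f := by
    intro f hf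
    have h : algebraMap R _ y * f ∈ smulQ (algebraMap R (FractionRing R) y) F :=
      mem_smulQ.mpr ⟨f, hf, rfl⟩
    obtain ⟨a, ha⟩ := Submodule.mem_one.mp (hyF h)
    exact ⟨a, by rw [hA, Submodule.mem_comap, Algebra.linearMap_apply, ha]; exact h, ha⟩
  obtain ⟨u, hu⟩ := hF
  obtain ⟨r, hrA, hr⟩ := memA u hu
  have hru : IsUnit (algebraMap R (FractionRing R) r) := hr ▸ hyu.mul u.isUnit
  have hxu : IsUnit (algebraMap R (FractionRing R) x) := by
    have : r ^ (n + 1) ∈ Ideal.span {x} * A ^ n := hn ▸ Ideal.pow_mem_pow hrA _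
    obtain ⟨c, hc⟩ := Ideal.mem_span_singleton'.mp (Ideal.mul_le_left this)
    have h := hru.pow (n + 1)
    rw [← map_pow, ← hc, map_mul] at h
    exact isUnit_of_mul_isUnit_right h
  obtain ⟨v, hv⟩ : IsUnit z := isUnit_of_mul_isUnit_left (hzy ▸ hxu)
  refine ⟨?_, v, hv, fun f hf => ?_⟩
  · obtain ⟨f, hf, h⟩ := mem_smulQ.mp (hxA (Ideal.mem_span_singleton_self x))
    have : z = f := hyu.mul_left_cancel (by rw [mul_comm, hzy]; exact h.symm)
    exact this ▸ hf
  · obtain ⟨a, haA, ha⟩ := memA f hf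
    let N : Submodule R (FractionRing R) := Submodule.map (Algebra.linearMap R _) (A ^ n)
    have hN : N.FG := (IsNoetherian.noetherian (A ^ n)).map _
    have hrN : algebraMap R (FractionRing R) (r ^ n) ∈ N := ⟨_, Ideal.pow_mem_pow hrA n, rfl⟩
    have hrnu : IsUnit (algebraMap R (FractionRing R) (r ^ n)) := by
      rw [map_pow]
      exact hru.pow n
    refine isIntegral_of_mul_mem hN hrN hrnu ?_
    rintro _ ⟨b, hb, rfl⟩
    have hab : a * b ∈ Ideal.span {x} * A ^ n := by
      rw [hn, pow_succ']
      exact Ideal.mul_mem_mul haA hb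
    obtain ⟨c, hc, hcx⟩ := Ideal.mem_span_singleton_mul.mp hab
    refine ⟨c, hc, hxu.mul_left_cancel ?_⟩
    have hcx := congrArg (algebraMap R (FractionRing R)) hcx
    rw [map_mul, map_mul] at hcx
    simp only [Algebra.linearMap_apply]
    rw [hcx, ha, ← hzy, ← hv]
    linear_combination (-(f * algebraMap R _ y * algebraMap R _ b)) * v.mul_inv

/-- If `g` generates `(R : I) R̄`, then `C ⊆ gI` for reflexive `I`. -/
theorem condC_le_smulQ {R : Type*} [CommRing R] {I : Submodule R (FractionRing R)}
    (hIrefl : (1 : Submodule R (FractionRing R)) / (1 / I) = I) {g : (FractionRing R)ˣ}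
    (hg : ∀ k ∈ 1 / I, IsIntegral R (k * (↑g⁻¹ : FractionRing R))) :
    condC R ≤ smulQ (g : FractionRing R) I := by
  intro c hc
  refine mem_smulQ.mpr ⟨↑g⁻¹ * c, ?_, g.mul_inv_cancel_left c⟩
  rw [← hIrefl, Submodule.mem_div_iff_forall_mul_mem]
  intro k hk
  have := Submodule.mem_div_iff_forall_mul_mem.mp hc _ (mem_Rbar.mpr (hg k hk))
  rwa [show ↑g⁻¹ * c * k = c * (k * (↑g⁻¹ : FractionRing R)) by ring]

theorem smulQ_le_one {R : Type*} [CommRing R] {I : Submodule R (FractionRing R)}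
    {g : FractionRing R} (hg : g ∈ 1 / I) : smulQ g I ≤ 1 := by
  intro x hx
  obtain ⟨t, ht, rfl⟩ := mem_smulQ.mp hx
  exact Submodule.mem_div_iff_forall_mul_mem.mp hg t ht

theorem statement_3
    (R : Type*) [CommRing R] [IsNoetherianRing R] [IsLocalRing R] [IsReduced R]
    (hdim : ringKrullDim R = 1)
    (hCM : ∃ x ∈ IsLocalRing.maximalIdeal R, x ∈ R⁰)
    [Infinite (IsLocalRing.ResidueField R)]
    (hfin : (Subalgebra.toSubmodule (integralClosure R (FractionRing R))).FG)
    (ω : Submodule R (FractionRing R)) (hωfrac : IsFracIdeal ω)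
    (hω1 : 1 ≤ ω) (hω2 : ω ≤ Rbar R)
    (hωcan : ∀ I : Submodule R (FractionRing R), IsFracIdeal I → ω / (ω / I) = I)
    (I : Submodule R (FractionRing R)) (hI : IsFracIdeal I)
    (hIrefl : (1 : Submodule R (FractionRing R)) / (1 / I) = I)
    (z : FractionRing R) (hz : IsFracReduction z (ω / I)) :
    (∃ w : FractionRing R, w ∈ Rbar R ∧ (∃ v ∈ Rbar R, w * v = 1) ∧
        condC R ≤ smulQ w (smulQ z I) ∧ smulQ w (smulQ z I) ≤ 1) ∧
    ∀ J : Submodule R (FractionRing R), IsFracIdeal J →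
      (1 : Submodule R (FractionRing R)) / (1 / J) = J →
      ∃ u : (FractionRing R)ˣ,
        condC R ≤ smulQ (u : FractionRing R) J ∧ smulQ (u : FractionRing R) J ≤ 1 := by
  have key : ∀ J : Submodule R (FractionRing R), IsFracIdeal J →
      ∃ g : (FractionRing R)ˣ, (g : FractionRing R) ∈ 1 / J ∧
        ∀ k ∈ 1 / J, IsIntegral R (k * (↑g⁻¹ : FractionRing R)) := fun J hJ => by
    obtain ⟨u, hu⟩ := hJ.one_div.1
    exact exists_unit_forall_isIntegral_mul_inv hdim hCM hJ.one_div.fg hu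
  refine ⟨?_, fun J hJ hJrefl => ?_⟩
  · obtain ⟨g, hgJ, hg⟩ := key I hI
    have hF := canonical_div_eq_mul_one_div hωfrac hωcan hI hIrefl
    obtain ⟨hzF, v, rfl, hv⟩ := hz.mem_and_isIntegral
      (hF ▸ (hωfrac.mul hI.one_div).1)
    have hgF : (g : FractionRing R) ∈ ω / I := by
      rw [hF, ← one_mul (g : FractionRing R)]
      exact Submodule.mul_mem_mul (hω1 (Submodule.mem_one.mpr ⟨1, map_one _⟩)) hgJ
    have hFg : ω * (1 / I) ≤ (Rbar R).comap (LinearMap.mulRight R (↑g⁻¹ : FractionRing R)) := by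
      rw [Submodule.mul_le]
      intro a ha b hb
      have : IsIntegral R (a * (b * (↑g⁻¹ : FractionRing R))) :=
        (mem_Rbar.mp (hω2 ha)).mul (hg b hb)
      rwa [← mul_assoc] at this
    have hwz : smulQ ((g : FractionRing R) * (↑v⁻¹ : FractionRing R))
        (smulQ (v : FractionRing R) I) = smulQ (g : FractionRing R) I := by
      rw [smulQ, smulQ, smulQ, ← mul_assoc, Submodule.span_mul_span,
        Set.singleton_mul_singleton, Units.inv_mul_cancel_right]
    refine ⟨g * ↑v⁻¹, hv _ hgF, ⟨v * ↑g⁻¹, hFg (hF ▸ hzF), ?_⟩, ?_, ?_⟩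
    · rw [mul_assoc, Units.inv_mul_cancel_left, Units.mul_inv]
    · rw [hwz]
      exact condC_le_smulQ hIrefl hg
    · rw [hwz]
      exact smulQ_le_one hgJ
  · obtain ⟨g, hgJ, hg⟩ := key J hJ
    exact ⟨g, condC_le_smulQ hJrefl hg, smulQ_le_one hgJ⟩
end
end

section
/- Let I be a proper, non-principal, reflexive regular ideal of R containing the conductor C, and let (x) be a minimal reduction of I. Then x(Ī:Ī) ⊆ I, where Ī denotes the integral closure of I. -/
open scoped nonZeroDivisors

noncomputable section

/-- If multiplication by `z` preserves a finitely generated submodule containing a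
non-zero-divisor, then `z` is integral. -/
theorem isIntegral_of_mul_mem_of_fg {R A : Type*} [CommRing R] [CommRing A] [Algebra R A]
    (N : Submodule R A) (hN : N.FG) {u : A} (hu : u ∈ N) (hreg : u ∈ A⁰)
    {z : A} (hz : ∀ n ∈ N, z * n ∈ N) : IsIntegral R z := by
  let f : Module.End R N := (LinearMap.mulLeft R z).restrict hz
  have : Module.Finite R N := Module.Finite.iff_fg.mpr hN
  obtain ⟨p, hp, hpf⟩ := LinearMap.exists_monic_and_aeval_eq_zero R f
  refine ⟨p, hp, ?_⟩
  have key : ∀ (q : Polynomial R) (n : N), ((Polynomial.aeval f q) n : A)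
      = Polynomial.aeval z q * n := by
    intro q
    induction q using Polynomial.induction_on' with
    | add a b ha hb => intro n; simp [ha, hb, add_mul]
    | monomial k a =>
      intro n
      have hpow : ∀ m : ℕ, (((f ^ m) n : N) : A) = z ^ m * n := by
        intro m
        induction m with
        | zero => simp
        | succ m ih =>
          rw [pow_succ', Module.End.mul_apply]
          change z * (((f ^ m) n : N) : A) = _
          rw [ih, pow_succ', mul_assoc]
      simp [Polynomial.aeval_monomial, hpow, Algebra.smul_def, mul_assoc]
  have h := key p ⟨u, hu⟩
  rw [hpf] at h
  rw [← Polynomial.aeval_def]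
  exact (mem_nonZeroDivisors_iff_right.mp hreg) _ (by simpa using h.symm)

/-- The conductor of `R` is an `R̄`-module. -/
theorem mul_mem_condC {R : Type*} [CommRing R] {c r : FractionRing R}
    (hc : c ∈ condC R) (hr : r ∈ Rbar R) : c * r ∈ condC R := by
  refine Submodule.mem_div_iff_forall_mul_mem.mpr fun s hs => ?_
  rw [mul_assoc]
  exact Submodule.mem_div_iff_forall_mul_mem.mp hc _
    ((integralClosure R (FractionRing R)).mul_mem hr hs)

theorem condC_le_one (R : Type*) [CommRing R] : condC R ≤ 1 := fun c hc => by
  simpa using Submodule.mem_div_iff_forall_mul_mem.mp hc 1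
    (integralClosure R (FractionRing R)).one_mem

/-- If `R̄` is a finite `R`-module, then the conductor contains a regular element. -/
theorem exists_regular_mem_condC {R : Type*} [CommRing R] (hfin : (Rbar R).FG) :
    ∃ u ∈ condC R, u ∈ (FractionRing R)⁰ := by
  obtain ⟨a, ha, hint⟩ := FractionalIdeal.isFractional_of_fg (S := R⁰) hfin
  refine ⟨algebraMap R _ a, ?_,
    (IsLocalization.map_units (FractionRing R) ⟨a, ha⟩).mem_nonZeroDivisors⟩
  refine Submodule.mem_div_iff_forall_mul_mem.mpr fun s hs => ?_
  obtain ⟨b, hb⟩ := hint s hs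
  exact Submodule.mem_one.mpr ⟨b, by rw [hb, Algebra.smul_def]⟩

/-- An element multiplying the conductor into `R` is integral over `R`. -/
theorem isIntegral_of_mul_condC_le_one {R : Type*} [CommRing R] [IsNoetherianRing R]
    (hfin : (Rbar R).FG) {z : FractionRing R} (hz : ∀ c ∈ condC R, z * c ∈ (1 : Submodule R _)) :
    IsIntegral R z := by
  obtain ⟨u, hu, hreg⟩ := exists_regular_mem_condC hfin
  have hfg : (condC R).FG := by
    have h1 : (1 : Submodule R (FractionRing R)).FG := by
      rw [Submodule.one_eq_span]
      exact Submodule.fg_span_singleton 1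
    have := isNoetherian_of_fg_of_noetherian _ h1
    exact isNoetherian_submodule.mp this _ (condC_le_one R)
  refine isIntegral_of_mul_mem_of_fg _ hfg hu hreg fun c hc =>
    Submodule.mem_div_iff_forall_mul_mem.mpr fun s hs => ?_
  rw [mul_assoc]
  exact hz _ (mul_mem_condC hc hs)

/-- If `z` is integral over `R`, `x ∈ I` and `x z = y ∈ R`, then `y` is integral over `I`. -/
theorem isIntegralOverIdeal_of_eq_mul {R : Type*} [CommRing R] {I : Ideal R} {x y : R}
    (hx : x ∈ I) {z : FractionRing R} (hz : IsIntegral R z)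
    (hy : algebraMap R (FractionRing R) y = algebraMap R (FractionRing R) x * z) :
    IsIntegralOverIdeal I y := by
  obtain ⟨p, hp, hpz⟩ := hz
  refine ⟨p.scaleRoots x, (Polynomial.monic_scaleRoots_iff x).mpr hp, fun i _ => ?_, ?_⟩
  · rw [Polynomial.coeff_scaleRoots, Polynomial.natDegree_scaleRoots]
    exact Ideal.mul_mem_left _ _ (Ideal.pow_mem_pow hx _)
  · apply IsFractionRing.injective R (FractionRing R)
    rw [map_zero, ← Polynomial.aeval_algebraMap_apply_eq_algebraMap_eval, hy]
    exact Polynomial.scaleRoots_aeval_eq_zero hpz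

theorem intCl_le_one {R : Type*} [CommRing R] (I : Ideal R) : intCl R I ≤ 1 :=
  Submodule.span_le.mpr (by rintro _ ⟨r, -, rfl⟩; exact Submodule.mem_one.mpr ⟨r, rfl⟩)

theorem statement_6
    (R : Type*) [CommRing R] [IsNoetherianRing R] [IsLocalRing R] [IsReduced R]
    (hdim : ringKrullDim R = 1)
    (hCM : ∃ x ∈ IsLocalRing.maximalIdeal R, x ∈ R⁰)
    [Infinite (IsLocalRing.ResidueField R)]
    (hfin : (Subalgebra.toSubmodule (integralClosure R (FractionRing R))).FG)
    (I : Ideal R) (hIreg : ∃ r ∈ I, r ∈ R⁰) (hIproper : I ≠ ⊤)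
    (hInp : ¬∃ r : R, I = Ideal.span {r})
    (hIrefl : (1 : Submodule R (FractionRing R)) / (1 / idl R I) = idl R I)
    (hCI : condC R ≤ idl R I)
    (x : R) (hx : IsMinimalReduction (Ideal.span {x}) I) :
    smulQ (algebraMap R (FractionRing R) x) (intCl R I / intCl R I) ≤ idl R I := by
  have hxI : x ∈ I := hx.1.1 (Ideal.mem_span_singleton_self x)
  rw [smulQ, ← hIrefl, Submodule.mul_le]
  intro a ha w hw
  obtain ⟨r, rfl⟩ := Submodule.mem_span_singleton.mp ha
  refine Submodule.mem_div_iff_forall_mul_mem.mpr fun z hz => ?_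
  rw [Submodule.mem_div_iff_forall_mul_mem] at hz hw
  have hzint : IsIntegral R z :=
    isIntegral_of_mul_condC_le_one hfin fun c hc => hz c (hCI hc)
  obtain ⟨y, hy⟩ := Submodule.mem_one.mp (hz _ (Submodule.mem_map_of_mem hxI))
  rw [Algebra.linearMap_apply, mul_comm] at hy
  have hyI : algebraMap R (FractionRing R) y ∈ intCl R I :=
    Submodule.subset_span ⟨y, isIntegralOverIdeal_of_eq_mul hxI hzint hy, rfl⟩
  have hwy := Submodule.smul_mem _ r (intCl_le_one I (hw _ hyI))
  rw [hy] at hwy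
  convert hwy using 1
  simp only [Algebra.smul_def]
  ring
end
end

section
/- The following are equivalent: (1) R is almost Gorenstein; (2) a non-principal fractional ideal I of R is reflexive if and only if ω_R ⊆ I:I; (3) a non-principal regular ideal I of R is reflexive if and only if ω_R ⊆ I:I. -/
open scoped nonZeroDivisors

noncomputable section

theorem mem_idl {R : Type*} [CommRing R] {I : Ideal R} {z : FractionRing R} :
    z ∈ idl R I ↔ ∃ r ∈ I, algebraMap R (FractionRing R) r = z :=
  Submodule.mem_map

theorem algebraMap_mem_idl {R : Type*} [CommRing R] {I : Ideal R} {r : R} :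
    algebraMap R (FractionRing R) r ∈ idl R I ↔ r ∈ I := by
  rw [mem_idl]
  refine ⟨?_, fun h => ⟨r, h, rfl⟩⟩
  rintro ⟨s, hs, h⟩
  rwa [← IsFractionRing.injective R (FractionRing R) h]

theorem idl_le_one {R : Type*} [CommRing R] (I : Ideal R) : idl R I ≤ 1 := by
  intro z hz
  obtain ⟨r, -, rfl⟩ := mem_idl.1 hz
  exact Submodule.mem_one.2 ⟨r, rfl⟩

theorem isFracIdeal_of_le_one {R : Type*} [CommRing R]
    {I : Submodule R (FractionRing R)} {r : R} (hr : r ∈ R⁰)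
    (hrI : algebraMap R (FractionRing R) r ∈ I) (hI : I ≤ 1) : IsFracIdeal I := by
  refine ⟨⟨(IsLocalization.map_units (FractionRing R) ⟨r, hr⟩).unit, by simpa using hrI⟩,
    1, one_mem _, ?_⟩
  rwa [smulQ, map_one, ← Submodule.one_eq_span, one_mul]

theorem exists_eq_span_of_idl_eq_span {R : Type*} [CommRing R] {I : Ideal R}
    (h : ∃ x : FractionRing R, idl R I = Submodule.span R {x}) :
    ∃ r : R, I = Ideal.span {r} := by
  obtain ⟨x, hx⟩ := h
  obtain ⟨r, hr, rfl⟩ := mem_idl.1 (hx ▸ Submodule.mem_span_singleton_self x : x ∈ idl R I)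
  refine ⟨r, le_antisymm (fun s hs => ?_) ((Ideal.span_singleton_le_iff_mem I).2 hr)⟩
  have := algebraMap_mem_idl.2 hs
  rw [hx, Submodule.mem_span_singleton] at this
  obtain ⟨a, ha⟩ := this
  refine Ideal.mem_span_singleton'.2 ⟨a, IsFractionRing.injective R (FractionRing R) ?_⟩
  rw [map_mul, ← ha, Algebra.smul_def]

/-- A fractional ideal that is a module over `ω : ω` is reflexive, because `R : I = ω : I`. -/
theorem one_div_one_div_eq_of_le_div {R : Type*} [CommRing R]
    {ω I : Submodule R (FractionRing R)} (hω1 : 1 ≤ ω)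
    (hcan1 : ω / (ω / 1) = 1) (hcan : ω / (ω / I) = I) (h : ω ≤ I / I) :
    (1 : Submodule R (FractionRing R)) / (1 / I) = I := by
  refine le_antisymm (fun q hq => ?_) (fun a ha => ?_)
  · rw [← hcan]
    intro t ht
    refine hω1 (hq t fun a ha => ?_)
    rw [← hcan1]
    intro w hw
    have hw' : w ∈ ω := by simpa using hw 1 (Submodule.one_le.1 le_rfl)
    have := ht _ (h hw' a ha)
    rwa [mul_assoc, mul_comm a w]
  · intro t ht
    rw [mul_comm]
    exact ht a ha

/-- Over a local ring, the product of an element of a non-principal module `I` with an element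
of `R : I` lies in the maximal ideal. -/
theorem mul_mem_idl_maximalIdeal {R : Type*} [CommRing R] [IsLocalRing R]
    {I : Submodule R (FractionRing R)}
    (hI : ¬∃ x : FractionRing R, I = Submodule.span R {x})
    {a t : FractionRing R} (ha : a ∈ I) (ht : t ∈ 1 / I) :
    a * t ∈ idl R (IsLocalRing.maximalIdeal R) := by
  obtain ⟨r, hr⟩ := Submodule.mem_one.1 (ht a ha)
  rw [mul_comm, ← hr, algebraMap_mem_idl]
  by_contra hrm
  obtain ⟨u, rfl⟩ := IsLocalRing.notMem_maximalIdeal.1 hrm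
  refine hI ⟨a, le_antisymm (fun b hb => ?_) ((Submodule.span_singleton_le_iff_mem a I).2 ha)⟩
  obtain ⟨s, hs⟩ := Submodule.mem_one.1 (ht b hb)
  refine Submodule.mem_span_singleton.2 ⟨↑u⁻¹ * s, ?_⟩
  have hu : algebraMap R (FractionRing R) ↑u⁻¹ * algebraMap R (FractionRing R) u = 1 := by
    rw [← map_mul, Units.inv_mul, map_one]
  rw [Algebra.smul_def, map_mul, hs]
  calc algebraMap R (FractionRing R) ↑u⁻¹ * (t * b) * a
      = algebraMap R (FractionRing R) ↑u⁻¹ * (t * a) * b := by ring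
    _ = b := by rw [← hr, hu, one_mul]

theorem le_div_self_of_one_div_one_div_eq {R : Type*} [CommRing R] [IsLocalRing R]
    {ω I : Submodule R (FractionRing R)}
    (hAG : idl R (IsLocalRing.maximalIdeal R) * ω ≤ idl R (IsLocalRing.maximalIdeal R))
    (hI : ¬∃ x : FractionRing R, I = Submodule.span R {x})
    (hrefl : (1 : Submodule R (FractionRing R)) / (1 / I) = I) : ω ≤ I / I := by
  intro w hw a ha
  rw [← hrefl]
  intro t ht
  have := idl_le_one _ (hAG (Submodule.mul_mem_mul (mul_mem_idl_maximalIdeal hI ha ht) hw))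
  rwa [mul_assoc, mul_comm w]

theorem maximalIdeal_eq_radical_span {R : Type*} [CommRing R] [IsLocalRing R]
    (hdim : ringKrullDim R = 1) {x : R} (hxm : x ∈ IsLocalRing.maximalIdeal R) (hx : x ∈ R⁰) :
    IsLocalRing.maximalIdeal R = (Ideal.span {x}).radical := by
  have hle : Ring.KrullDimLE 1 R := Ring.krullDimLE_iff.2 (by simp [hdim])
  refine le_antisymm ?_ ?_
  · rw [Ideal.radical_eq_sInf]
    refine le_sInf fun P hP => ?_
    rcases Ring.krullDimLE_one_iff.1 hle P hP.2 with hmin | hmax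
    · exact absurd hx (notMem_nonZeroDivisors_of_mem_mem_minimalPrimes
        (hP.1 (Ideal.mem_span_singleton_self x)) hmin)
    · exact (IsLocalRing.eq_maximalIdeal hmax).ge
  · exact (Ideal.IsPrime.radical_le_iff inferInstance).2
      ((Ideal.span_singleton_le_iff_mem _).2 hxm)

theorem exists_mem_one_div_notMem_one {R : Type*} [CommRing R] [IsNoetherianRing R]
    [IsLocalRing R] (hdim : ringKrullDim R = 1)
    (hCM : ∃ x ∈ IsLocalRing.maximalIdeal R, x ∈ R⁰) :
    ∃ z : FractionRing R, z ∈ (1 : Submodule R (FractionRing R)) /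
      idl R (IsLocalRing.maximalIdeal R) ∧ z ∉ (1 : Submodule R (FractionRing R)) := by
  classical
  obtain ⟨x, hxm, hx⟩ := hCM
  have hpow : ∃ n, IsLocalRing.maximalIdeal R ^ n ≤ Ideal.span {x} :=
    Ideal.exists_pow_le_of_le_radical_of_fg (maximalIdeal_eq_radical_span hdim hxm hx).le
      (IsNoetherian.noetherian _)
  have hspec := Nat.find_spec hpow
  have hmin := fun k => Nat.find_min (H := hpow) (m := k)
  generalize Nat.find hpow = n at hspec hmin
  cases n with
  | zero =>
    rw [pow_zero, Ideal.one_eq_top] at hspec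
    exact absurd (hspec Submodule.mem_top) fun h =>
      (Ideal.ne_top_iff_one _).1 (IsLocalRing.maximalIdeal.isMaximal R).ne_top
        ((Ideal.span_singleton_le_iff_mem _).2 hxm h)
  | succ n =>
    obtain ⟨y, hy, hyx⟩ := SetLike.not_le_iff_exists.1 (hmin n n.lt_succ_self)
    refine ⟨IsLocalization.mk' (FractionRing R) y ⟨x, hx⟩, fun b hb => ?_, fun h => ?_⟩
    · obtain ⟨b, hbm, rfl⟩ := mem_idl.1 hb
      have : y * b ∈ Ideal.span {x} := hspec (pow_succ (IsLocalRing.maximalIdeal R) n ▸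
        Ideal.mul_mem_mul hy hbm)
      obtain ⟨c, hc⟩ := Ideal.mem_span_singleton'.1 this
      refine Submodule.mem_one.2 ⟨c, ?_⟩
      rw [mul_comm, IsLocalization.mul_mk'_eq_mk'_of_mul, IsLocalization.eq_mk'_iff_mul_eq,
        ← map_mul, hc, mul_comm]
    · obtain ⟨c, hc⟩ := Submodule.mem_one.1 h
      rw [IsLocalization.eq_mk'_iff_mul_eq, ← map_mul] at hc
      exact hyx (Ideal.mem_span_singleton'.2 ⟨c, IsFractionRing.injective R _ hc⟩)

theorem maximalIdeal_reflexive {R : Type*} [CommRing R] [IsNoetherianRing R]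
    [IsLocalRing R] (hdim : ringKrullDim R = 1)
    (hCM : ∃ x ∈ IsLocalRing.maximalIdeal R, x ∈ R⁰) :
    (1 : Submodule R (FractionRing R)) / (1 / idl R (IsLocalRing.maximalIdeal R)) =
      idl R (IsLocalRing.maximalIdeal R) := by
  refine le_antisymm (fun q hq => ?_) fun a ha t ht => mul_comm a t ▸ ht a ha
  have h1 : (1 : FractionRing R) ∈ (1 : Submodule R (FractionRing R)) /
      idl R (IsLocalRing.maximalIdeal R) :=
    fun b hb => (one_mul b).symm ▸ idl_le_one _ hb
  have hq1 := hq 1 h1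
  rw [mul_one] at hq1
  obtain ⟨r, rfl⟩ := Submodule.mem_one.1 hq1
  rw [algebraMap_mem_idl]
  by_contra hrm
  obtain ⟨u, rfl⟩ := IsLocalRing.notMem_maximalIdeal.1 hrm
  obtain ⟨z, hz, hz1⟩ := exists_mem_one_div_notMem_one hdim hCM
  obtain ⟨s, hs⟩ := Submodule.mem_one.1 (hq z hz)
  refine hz1 (Submodule.mem_one.2 ⟨↑u⁻¹ * s, ?_⟩)
  rw [map_mul, hs, ← mul_assoc, ← map_mul, Units.inv_mul, map_one, one_mul]

theorem isDomain_of_maximalIdeal_eq_span {R : Type*} [CommRing R] [IsNoetherianRing R]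
    [IsLocalRing R] {x : R} (hx : x ∈ R⁰)
    (h : IsLocalRing.maximalIdeal R = Ideal.span {x}) : IsDomain R := by
  obtain ⟨P, hP, hPm⟩ := Ideal.exists_minimalPrimes_le
    (bot_le : (⊥ : Ideal R) ≤ IsLocalRing.maximalIdeal R)
  have hprime : P.IsPrime := hP.1.1
  have hxP : x ∉ P := fun hxP => notMem_nonZeroDivisors_of_mem_mem_minimalPrimes hxP hP hx
  have hbot : P = ⊥ := by
    refine Submodule.eq_bot_of_le_smul_of_le_jacobson_bot (IsLocalRing.maximalIdeal R) P
      (IsNoetherian.noetherian _) (fun p hp => ?_) (IsLocalRing.maximalIdeal_le_jacobson _)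
    obtain ⟨c, rfl⟩ := Ideal.mem_span_singleton'.1 (h ▸ hPm hp)
    rw [mul_comm]
    exact Submodule.smul_mem_smul (h ▸ Ideal.mem_span_singleton_self x)
      ((hprime.mem_or_mem hp).resolve_right hxP)
  rw [hbot] at hprime
  exact IsDomain.of_bot_isPrime R

theorem Rbar_le_one_of_maximalIdeal_eq_span {R : Type*} [CommRing R] [IsNoetherianRing R]
    [IsLocalRing R] {x : R} (hx : x ∈ R⁰)
    (h : IsLocalRing.maximalIdeal R = Ideal.span {x}) : Rbar R ≤ 1 := by
  have := isDomain_of_maximalIdeal_eq_span hx h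
  have hprin : (IsLocalRing.maximalIdeal R).IsPrincipal := ⟨x, h⟩
  have htfae := (tfae_of_isNoetherianRing_of_isLocalRing_of_isDomain R).out 4 3
  have : IsIntegrallyClosed R := (htfae.1 hprin).1
  intro z hz
  exact Submodule.mem_one.2 (IsIntegrallyClosed.algebraMap_eq_of_integral (R := R) hz)

theorem statement_10
    (R : Type*) [CommRing R] [IsNoetherianRing R] [IsLocalRing R] [IsReduced R]
    (hdim : ringKrullDim R = 1)
    (hCM : ∃ x ∈ IsLocalRing.maximalIdeal R, x ∈ R⁰)
    [Infinite (IsLocalRing.ResidueField R)]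
    (hfin : (Subalgebra.toSubmodule (integralClosure R (FractionRing R))).FG)
    (ω : Submodule R (FractionRing R)) (hωfrac : IsFracIdeal ω)
    (hω1 : 1 ≤ ω) (hω2 : ω ≤ Rbar R)
    (hωcan : ∀ I : Submodule R (FractionRing R), IsFracIdeal I → ω / (ω / I) = I) :
    ((idl R (IsLocalRing.maximalIdeal R) * ω ≤ idl R (IsLocalRing.maximalIdeal R)) ↔
      (∀ I : Submodule R (FractionRing R), IsFracIdeal I →
        (¬∃ x : FractionRing R, I = Submodule.span R {x}) →
        (((1 : Submodule R (FractionRing R)) / (1 / I) = I) ↔ ω ≤ I / I))) ∧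
    ((idl R (IsLocalRing.maximalIdeal R) * ω ≤ idl R (IsLocalRing.maximalIdeal R)) ↔
      (∀ I : Ideal R, (∃ r ∈ I, r ∈ R⁰) →
        (¬∃ r : R, I = Ideal.span {r}) →
        (((1 : Submodule R (FractionRing R)) / (1 / idl R I) = idl R I) ↔
          ω ≤ idl R I / idl R I))) := by
  have hm : IsFracIdeal (idl R (IsLocalRing.maximalIdeal R)) := by
    obtain ⟨x, hxm, hx⟩ := hCM
    exact isFracIdeal_of_le_one hx (algebraMap_mem_idl.2 hxm) (idl_le_one _)
  have hcan1 := hωcan 1 (isFracIdeal_of_le_one (one_mem _)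
    (Submodule.mem_one.2 ⟨1, rfl⟩) le_rfl)
  have hfrac : (idl R (IsLocalRing.maximalIdeal R) * ω ≤ idl R (IsLocalRing.maximalIdeal R)) →
      ∀ I : Submodule R (FractionRing R), IsFracIdeal I →
        (¬∃ x : FractionRing R, I = Submodule.span R {x}) →
        (((1 : Submodule R (FractionRing R)) / (1 / I) = I) ↔ ω ≤ I / I) :=
    fun hAG I hI hnp => ⟨le_div_self_of_one_div_one_div_eq hAG hnp,
      one_div_one_div_eq_of_le_div hω1 hcan1 (hωcan I hI)⟩
  have hideal : (∀ I : Submodule R (FractionRing R), IsFracIdeal I →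
        (¬∃ x : FractionRing R, I = Submodule.span R {x}) →
        (((1 : Submodule R (FractionRing R)) / (1 / I) = I) ↔ ω ≤ I / I)) →
      ∀ I : Ideal R, (∃ r ∈ I, r ∈ R⁰) →
        (¬∃ r : R, I = Ideal.span {r}) →
        (((1 : Submodule R (FractionRing R)) / (1 / idl R I) = idl R I) ↔
          ω ≤ idl R I / idl R I) := by
    rintro h I ⟨r, hrI, hr⟩ hnp
    exact h _ (isFracIdeal_of_le_one hr (algebraMap_mem_idl.2 hrI) (idl_le_one _))
      fun hp => hnp (exists_eq_span_of_idl_eq_span hp)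
  have hback : (∀ I : Ideal R, (∃ r ∈ I, r ∈ R⁰) →
        (¬∃ r : R, I = Ideal.span {r}) →
        (((1 : Submodule R (FractionRing R)) / (1 / idl R I) = idl R I) ↔
          ω ≤ idl R I / idl R I)) →
      idl R (IsLocalRing.maximalIdeal R) * ω ≤ idl R (IsLocalRing.maximalIdeal R) := by
    intro h
    by_cases hp : ∃ r : R, IsLocalRing.maximalIdeal R = Ideal.span {r}
    · obtain ⟨x, hx⟩ := hp
      obtain ⟨y, hym, hy⟩ := hCM
      obtain ⟨c, rfl⟩ := Ideal.mem_span_singleton'.1 (hx ▸ hym)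
      have hω : ω ≤ 1 :=
        hω2.trans (Rbar_le_one_of_maximalIdeal_eq_span (mul_mem_nonZeroDivisors.1 hy).2 hx)
      exact (mul_le_mul_right hω _).trans_eq (mul_one _)
    · have hω := (h _ hCM hp).1 (maximalIdeal_reflexive hdim hCM)
      exact Submodule.mul_le.2 fun a ha w hw => mul_comm w a ▸ hω hw a ha
  exact ⟨⟨hfrac, fun h => hback (hideal h)⟩, ⟨fun h => hideal (hfrac h), hback⟩⟩
end
end
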